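/- arXiv:0905.4491 — 6 statements merged into one kernel-verified Lean document; each statement's English description precedes it below -/
import Mathlib

section
/- For all natural numbers n, k, every infinitely differentiable function f : ℝ → ℂ, and every x ∈ ℝ, the commutator identity [Pⁿ, Qᵏ] = Σ_{h=1}^{n} (−i)ʰ·C(n,h)·k⁽ʰ⁾·Q^{k−h}∘P^{n−h} holds pointwise; that is, (Pⁿ(Qᵏf))(x) − (Qᵏ(Pⁿf))(x) = Σ_{h=1}^{n} (−i)ʰ · C(n,h) · k⁽ʰ⁾ · x^{k−h} · (P^{n−h}f)(x), where the terms with h > k vanish because k⁽ʰ⁾ = 0 (so the exponent k−h may be read with truncated natural subtraction). -/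
open Finset

/-- The momentum operator `(Pf)(x) = -i f'(x)` on complex-valued functions on `ℝ`. -/
noncomputable def momentumOp (f : ℝ → ℂ) : ℝ → ℂ := fun x => -Complex.I * deriv f x

/-- The position operator `(Qf)(x) = x f(x)` on complex-valued functions on `ℝ`. -/
noncomputable def positionOp (f : ℝ → ℂ) : ℝ → ℂ := fun x => (x : ℂ) * f x

theorem momentumOp_iterate_eq (n : ℕ) (f : ℝ → ℂ) :
    momentumOp^[n] f = fun x => (-Complex.I) ^ n * iteratedDeriv n f x := by
  induction n with
  | zero => simp
  | succ n ih =>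
    ext x
    rw [Function.iterate_succ_apply', ih, momentumOp, deriv_const_mul_field, ← iteratedDeriv_succ,
      pow_succ']
    ring

theorem positionOp_iterate_eq (k : ℕ) (f : ℝ → ℂ) :
    positionOp^[k] f = fun x : ℝ => (x : ℂ) ^ k * f x := by
  induction k with
  | zero => simp
  | succ k ih =>
    ext x
    rw [Function.iterate_succ_apply', ih, positionOp, pow_succ']
    ring

theorem iteratedDeriv_ofReal_pow (k h : ℕ) :
    iteratedDeriv h (fun x : ℝ => (x : ℂ) ^ k) =
      fun x : ℝ => (k.descFactorial h : ℂ) * (x : ℂ) ^ (k - h) := by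
  induction h with
  | zero => simp
  | succ h ih =>
    ext x
    have hd : HasDerivAt (fun y : ℝ => (y : ℂ)) 1 x := (hasDerivAt_id x).ofReal_comp
    rw [iteratedDeriv_succ, ih, deriv_const_mul_field, (hd.fun_pow (k - h)).deriv, Nat.descFactorial_succ,
      ← Nat.sub_sub]
    push_cast
    simp
    ring

/-- The commutator identity
`[Pⁿ, Qᵏ] = Σ_{h=1}^{n} (−i)ʰ C(n,h) k⁽ʰ⁾ Q^{k−h} P^{n−h}`, pointwise on smooth functions. -/
theorem pow_momentum_pow_position_commutator (n k : ℕ) (f : ℝ → ℂ)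
    (hf : ContDiff ℝ (⊤ : ℕ∞) f) (x : ℝ) :
    momentumOp^[n] (positionOp^[k] f) x - positionOp^[k] (momentumOp^[n] f) x =
      ∑ h ∈ Finset.Icc 1 n,
        (-Complex.I) ^ h * (n.choose h : ℂ) * (k.descFactorial h : ℂ) *
          (x : ℂ) ^ (k - h) * momentumOp^[n - h] f x := by
  have hpow : ContDiff ℝ (⊤ : ℕ∞) (fun x : ℝ => (x : ℂ) ^ k) :=
    Complex.ofRealCLM.contDiff.pow k
  have hn : (n : WithTop ℕ∞) ≤ ((⊤ : ℕ∞) : WithTop ℕ∞) := mod_cast le_top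
  simp only [positionOp_iterate_eq, momentumOp_iterate_eq]
  rw [iteratedDeriv_fun_mul (hpow.of_le hn).contDiffAt (hf.of_le hn).contDiffAt,
    Finset.range_eq_Ico, Finset.sum_eq_sum_Ico_succ_bot n.succ_pos, mul_add]
  simp only [iteratedDeriv_ofReal_pow]
  simp only [Nat.choose_zero_right, Nat.descFactorial_zero, Nat.cast_one, one_mul, Nat.sub_zero,
    zero_add, mul_left_comm ((-Complex.I) ^ n) ((x : ℂ) ^ k), add_sub_cancel_left, Finset.mul_sum]
  refine Finset.sum_congr rfl fun h hh => ?_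
  have hle : h ≤ n := (Finset.mem_Icc.mp hh).2
  rw [← pow_mul_pow_sub (-Complex.I) hle]
  ring
end

section
/- Let {f,g} := (∂f/∂x)(∂g/∂y) − (∂f/∂y)(∂g/∂x) denote the Poisson bracket of smooth functions ℝ² → ℂ. For all natural numbers n, k, N, K with n + N ≥ 1 and k + K ≥ 1, the functions g_{n,k}(x,y) := ((x+iy)/√2)ⁿ·((x−iy)/√2)ᵏ satisfy {g_{n,k}, g_{N,K}}(x,y) = i·(kN − nK)·g_{n+N−1, k+K−1}(x,y) for every (x,y) ∈ ℝ². -/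
/-- The Poisson bracket `{f,g} = (∂f/∂x)(∂g/∂y) − (∂f/∂y)(∂g/∂x)` of functions `ℝ² → ℂ`. -/
noncomputable def poissonBracket (f g : ℝ × ℝ → ℂ) : ℝ × ℝ → ℂ := fun p =>
  deriv (fun t => f (t, p.2)) p.1 * deriv (fun t => g (p.1, t)) p.2 -
    deriv (fun t => f (p.1, t)) p.2 * deriv (fun t => g (t, p.2)) p.1

/-- The classical RHPWN generators `g_{n,k}(x,y) = ((x+iy)/√2)ⁿ ((x−iy)/√2)ᵏ`. -/
noncomputable def rhpwnFun (n k : ℕ) : ℝ × ℝ → ℂ := fun p =>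
  (((p.1 : ℂ) + Complex.I * (p.2 : ℂ)) / (Real.sqrt 2 : ℂ)) ^ n *
    (((p.1 : ℂ) - Complex.I * (p.2 : ℂ)) / (Real.sqrt 2 : ℂ)) ^ k

theorem hasDerivAt_rhpwnFun_fst (n k : ℕ) (p : ℝ × ℝ) :
    HasDerivAt (fun t => rhpwnFun n k (t, p.2))
      ((n * rhpwnFun (n - 1) k p + k * rhpwnFun n (k - 1) p) / (Real.sqrt 2 : ℂ)) p.1 := by
  have hx : HasDerivAt (fun t : ℝ => (t : ℂ)) 1 p.1 := Complex.ofRealCLM.hasDerivAt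
  have hz := (hx.add_const (Complex.I * (p.2 : ℂ))).div_const (Real.sqrt 2 : ℂ)
  have hw := (hx.sub_const (Complex.I * (p.2 : ℂ))).div_const (Real.sqrt 2 : ℂ)
  refine ((hz.fun_pow n).fun_mul (hw.fun_pow k)).congr_deriv ?_
  simp only [rhpwnFun]
  ring

theorem hasDerivAt_rhpwnFun_snd (n k : ℕ) (p : ℝ × ℝ) :
    HasDerivAt (fun t => rhpwnFun n k (p.1, t))
      (Complex.I * (n * rhpwnFun (n - 1) k p - k * rhpwnFun n (k - 1) p) /
        (Real.sqrt 2 : ℂ)) p.2 := by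
  have hy : HasDerivAt (fun t : ℝ => Complex.I * (t : ℂ)) (Complex.I * 1) p.2 :=
    Complex.ofRealCLM.hasDerivAt.const_mul Complex.I
  have hz := (hy.const_add (p.1 : ℂ)).div_const (Real.sqrt 2 : ℂ)
  have hw := (hy.const_sub (p.1 : ℂ)).div_const (Real.sqrt 2 : ℂ)
  refine ((hz.fun_pow n).fun_mul (hw.fun_pow k)).congr_deriv ?_
  simp only [rhpwnFun]
  ring

theorem rhpwnFun_mul_rhpwnFun (n k N K : ℕ) (p : ℝ × ℝ) :
    rhpwnFun n k p * rhpwnFun N K p = rhpwnFun (n + N) (k + K) p := by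
  simp only [rhpwnFun, pow_add]
  ring

theorem natCast_mul_rhpwnFun_mul_rhpwnFun (n k N K : ℕ) (p : ℝ × ℝ) :
    (k * N : ℂ) * (rhpwnFun n (k - 1) p * rhpwnFun (N - 1) K p) =
      (k * N : ℂ) * rhpwnFun (n + N - 1) (k + K - 1) p := by
  rcases Nat.eq_zero_or_pos k with rfl | hk
  · simp
  rcases Nat.eq_zero_or_pos N with rfl | hN
  · simp
  rw [rhpwnFun_mul_rhpwnFun, Nat.add_sub_assoc hN, Nat.sub_add_comm hk]

/-- `{g_{n,k}, g_{N,K}} = i (kN − nK) g_{n+N−1, k+K−1}` whenever `n+N ≥ 1` and `k+K ≥ 1`. -/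
theorem poissonBracket_rhpwnFun (n k N K : ℕ) (hnN : 1 ≤ n + N) (hkK : 1 ≤ k + K)
    (p : ℝ × ℝ) :
    poissonBracket (rhpwnFun n k) (rhpwnFun N K) p =
      Complex.I * ((k * N - n * K : ℤ) : ℂ) * rhpwnFun (n + N - 1) (k + K - 1) p := by
  have hsqrt : (Real.sqrt 2 : ℂ) ^ 2 = 2 := by
    rw [← Complex.ofReal_pow, Real.sq_sqrt zero_le_two, Complex.ofReal_ofNat]
  have hsqrt0 : (Real.sqrt 2 : ℂ) ≠ 0 := by simp
  have h₁ := natCast_mul_rhpwnFun_mul_rhpwnFun n k N K p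
  have h₂ := natCast_mul_rhpwnFun_mul_rhpwnFun N K n k p
  rw [add_comm N n, add_comm K k] at h₂
  simp only [poissonBracket, (hasDerivAt_rhpwnFun_fst _ _ p).deriv,
    (hasDerivAt_rhpwnFun_snd _ _ p).deriv]
  push_cast
  field_simp
  rw [hsqrt]
  linear_combination 2 * h₁ - 2 * h₂
end

section
/- For every constant c ∈ ℂ and every commutative ℂ-algebra A, there exists a Lie algebra structure (over ℂ) on the free A-module with basis {B^n_k : (n,k) ∈ ℕ×ℕ} whose bracket is ℂ-bilinear and satisfies, for all f, g ∈ A and all N, K, n, k ∈ ℕ, ⁅g·B^N_K, f·B^n_k⁆ = Σ_{L=1}^{max(min(K,n), min(k,N))} θ_L(N,K;n,k) · c^{L−1} · (g·f)·B^{N+n−L}_{K+k−L}. In particular, this bracket is antisymmetric and satisfies the Jacobi identity (every term with θ_L(N,K;n,k) = 0 is understood to be 0, so all occurring indices N+n−L, K+k−L are nonnegative). -/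
open Finset

/-- `ε_{a,b} := 1 − δ_{a,b}` (Kronecker delta). -/
def eps (a b : ℕ) : ℤ := if a = b then 0 else 1

/-- The RHPWN structure constants obtained from Ivanov's renormalization:
`θ_L(N,K;n,k) = ε_{K,0} ε_{n,0} C(K,L) n⁽ᴸ⁾ − ε_{k,0} ε_{N,0} C(k,L) N⁽ᴸ⁾`. -/
def theta (L N K n k : ℕ) : ℤ :=
  eps K 0 * eps n 0 * (K.choose L : ℤ) * (n.descFactorial L : ℤ) -
    eps k 0 * eps N 0 * (k.choose L : ℤ) * (N.descFactorial L : ℤ)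

namespace RHPWN

variable {R : Type*} [CommRing R]

/-- Left multiplication by `B^1_0` in the normally ordered Weyl algebra. -/
noncomputable def raise (R : Type*) [CommRing R] : Module.End R ((ℕ × ℕ) →₀ R) :=
  Finsupp.lmapDomain R R fun p => (p.1 + 1, p.2)

/-- The map `B^n_k ↦ B^n_{k+1}`. -/
noncomputable def shift (R : Type*) [CommRing R] : Module.End R ((ℕ × ℕ) →₀ R) :=
  Finsupp.lmapDomain R R fun p => (p.1, p.2 + 1)

/-- The map `B^n_k ↦ c n B^{n-1}_k`. -/
noncomputable def lower (c : R) : Module.End R ((ℕ × ℕ) →₀ R) :=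
  Finsupp.linearCombination R fun p => Finsupp.single (p.1 - 1, p.2) (c * p.1)

/-- Left multiplication by `B^0_1` in the normally ordered Weyl algebra with `[B^0_1, B^1_0] = c`. -/
noncomputable def annihilate (c : R) : Module.End R ((ℕ × ℕ) →₀ R) := lower c + shift R

/-- The normally ordered (star) product with `B^0_1 ⋆ B^1_0 = B^1_1 + c B^0_0`, as the left regular
representation. -/
noncomputable def star (c : R) : ((ℕ × ℕ) →₀ R) →ₗ[R] Module.End R ((ℕ × ℕ) →₀ R) :=
  Finsupp.linearCombination R fun p => raise R ^ p.1 * annihilate c ^ p.2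

lemma raise_single (n k : ℕ) (r : R) :
    raise R (Finsupp.single (n, k) r) = Finsupp.single (n + 1, k) r := by
  simp [raise]

lemma shift_single (n k : ℕ) (r : R) :
    shift R (Finsupp.single (n, k) r) = Finsupp.single (n, k + 1) r := by
  simp [shift]

lemma lower_single (c : R) (n k : ℕ) (r : R) :
    lower c (Finsupp.single (n, k) r) = Finsupp.single (n - 1, k) (r * (c * n)) := by
  rw [lower, Finsupp.linearCombination_single, Finsupp.smul_single, smul_eq_mul]

lemma raise_pow_single (N n k : ℕ) (r : R) :
    (raise R ^ N) (Finsupp.single (n, k) r) = Finsupp.single (N + n, k) r := by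
  induction N with
  | zero => simp
  | succ N ih =>
    rw [pow_succ', Module.End.mul_apply, ih, raise_single]
    congr 2; omega

lemma shift_pow_single (K n k : ℕ) (r : R) :
    (shift R ^ K) (Finsupp.single (n, k) r) = Finsupp.single (n, K + k) r := by
  induction K with
  | zero => simp
  | succ K ih =>
    rw [pow_succ', Module.End.mul_apply, ih, shift_single]
    congr 2; omega

lemma lower_pow_single (c : R) (L n k : ℕ) (r : R) :
    (lower c ^ L) (Finsupp.single (n, k) r) =
      Finsupp.single (n - L, k) (r * (n.descFactorial L * c ^ L)) := by
  induction L with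
  | zero => simp
  | succ L ih =>
    rw [pow_succ', Module.End.mul_apply, ih, lower_single, Nat.descFactorial_succ, Nat.sub_sub]
    congr 1
    push_cast
    ring

lemma commute_lower_shift (c : R) : Commute (lower c) (shift R) := by
  refine Finsupp.lhom_ext fun ⟨n, k⟩ r => ?_
  simp only [Module.End.mul_apply, shift_single, lower_single]

lemma annihilate_mul_raise (c : R) :
    annihilate c * raise R = raise R * annihilate c + c • 1 := by
  refine Finsupp.lhom_ext fun ⟨n, k⟩ r => ?_
  simp only [annihilate, Module.End.mul_apply, LinearMap.add_apply, raise_single, lower_single,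
    shift_single, map_add, LinearMap.smul_apply, Module.End.one_apply, Finsupp.smul_single,
    smul_eq_mul]
  rcases n with _ | n
  · simp [add_comm, mul_comm]
  · rw [Nat.add_sub_cancel, Nat.add_sub_cancel, add_right_comm (Finsupp.single _ _),
      ← Finsupp.single_add]
    congr 2
    push_cast
    ring

lemma annihilate_mul_raise_pow (c : R) (n : ℕ) :
    annihilate c * raise R ^ n = raise R ^ n * annihilate c + (c * n) • raise R ^ (n - 1) := by
  induction n with
  | zero => simp
  | succ n ih =>
    rw [pow_succ, ← mul_assoc, ih, add_mul, mul_assoc, annihilate_mul_raise, mul_add,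
      smul_mul_assoc, mul_smul_comm, mul_one, mul_assoc, add_assoc, Nat.add_sub_cancel]
    congr 1
    rcases n with _ | n
    · simp
    · rw [Nat.add_sub_cancel, ← pow_succ, ← add_smul]
      congr 1
      push_cast
      ring

lemma star_single (c : R) (n k : ℕ) (r : R) :
    star c (Finsupp.single (n, k) r) = r • (raise R ^ n * annihilate c ^ k) := by
  simp [star]

lemma star_raise (c : R) (v : (ℕ × ℕ) →₀ R) : star c (raise R v) = raise R * star c v := by
  induction v using Finsupp.induction_linear with
  | zero => simp
  | add u v hu hv => simp only [map_add, hu, hv, mul_add]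
  | single p r =>
    rw [raise_single, star_single, star_single, pow_succ', mul_assoc, mul_smul_comm]

lemma star_annihilate (c : R) (v : (ℕ × ℕ) →₀ R) :
    star c (annihilate c v) = annihilate c * star c v := by
  induction v using Finsupp.induction_linear with
  | zero => simp
  | add u v hu hv => simp only [map_add, hu, hv, mul_add]
  | single p r =>
    obtain ⟨n, k⟩ := p
    rw [star_single, mul_smul_comm, ← mul_assoc, annihilate_mul_raise_pow, annihilate,
      LinearMap.add_apply, map_add, lower_single, shift_single, star_single, star_single,
      add_mul, smul_mul_assoc, smul_add, smul_smul, mul_assoc, ← annihilate, ← pow_succ', add_comm]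

lemma star_star (c : R) (u v : (ℕ × ℕ) →₀ R) : star c (star c u v) = star c u * star c v := by
  have hr (N : ℕ) (w) : star c ((raise R ^ N) w) = raise R ^ N * star c w := by
    induction N with
    | zero => simp
    | succ N ih => rw [pow_succ', Module.End.mul_apply, star_raise, ih, mul_assoc]
  have ha (K : ℕ) (w) : star c ((annihilate c ^ K) w) = annihilate c ^ K * star c w := by
    induction K with
    | zero => simp
    | succ K ih => rw [pow_succ', Module.End.mul_apply, star_annihilate, ih, mul_assoc]
  induction u using Finsupp.induction_linear with
  | zero => simp
  | add u u' hu hv => simp only [map_add, LinearMap.add_apply, hu, hv, add_mul]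
  | single p r =>
    rw [star_single, LinearMap.smul_apply, map_smul, Module.End.mul_apply, hr, ha, smul_mul_assoc,
      mul_assoc]

lemma star_single_single (c : R) {N K n k m : ℕ} (hm : K ≤ m) :
    star c (Finsupp.single (N, K) 1) (Finsupp.single (n, k) 1) =
      ∑ L ∈ Finset.range (m + 1), Finsupp.single (N + n - L, K + k - L)
        ((K.choose L * n.descFactorial L : R) * c ^ L) := by
  rw [← Finset.sum_subset (Finset.range_subset_range.2 (Nat.succ_le_succ hm))]
  · rw [star_single, one_smul, Module.End.mul_apply, annihilate, (commute_lower_shift c).add_pow,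
      LinearMap.sum_apply, map_sum]
    refine Finset.sum_congr rfl fun L hL => ?_
    have hLK : L ≤ K := Nat.lt_succ_iff.1 (Finset.mem_range.1 hL)
    rw [← nsmul_eq_mul', LinearMap.smul_apply, Module.End.mul_apply, shift_pow_single,
      lower_pow_single, map_nsmul, raise_pow_single, Finsupp.smul_single]
    rcases le_or_gt L n with hn | hn
    · rw [nsmul_eq_mul, one_mul, mul_assoc]
      congr 2 <;> omega
    · simp [Nat.descFactorial_of_lt hn]
  · intro L _ hL
    rw [Nat.choose_eq_zero_of_lt (by simpa using hL)]
    simp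

/-- The bracket of two basis vectors. -/
noncomputable def basisBracket (c : R) (p q : ℕ × ℕ) : (ℕ × ℕ) →₀ R :=
  ∑ L ∈ Finset.Icc 1 (max (min p.2 q.1) (min q.2 p.1)),
    Finsupp.single (p.1 + q.1 - L, p.2 + q.2 - L) ((theta L p.1 p.2 q.1 q.2 : R) * c ^ (L - 1))

/-- The Ivanov-renormalized bracket of higher powers of white noise, over any coefficient ring. -/
noncomputable def bracket (c : R) :
    ((ℕ × ℕ) →₀ R) →ₗ[R] ((ℕ × ℕ) →₀ R) →ₗ[R] ((ℕ × ℕ) →₀ R) :=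
  Finsupp.linearCombination R fun p => Finsupp.linearCombination R (basisBracket c p)

lemma bracket_single (c : R) (p q : ℕ × ℕ) (r s : R) :
    bracket c (Finsupp.single p r) (Finsupp.single q s) = (r * s) • basisBracket c p q := by
  simp [bracket, smul_smul]

lemma theta_of_pos {L : ℕ} (hL : 0 < L) (N K n k : ℕ) :
    theta L N K n k = K.choose L * n.descFactorial L - k.choose L * N.descFactorial L := by
  obtain ⟨L, rfl⟩ := Nat.exists_eq_succ_of_ne_zero hL.ne'
  have h (a b : ℕ) : eps a 0 * eps b 0 * (a.choose (L + 1) : ℤ) * (b.descFactorial (L + 1) : ℤ) =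
      a.choose (L + 1) * b.descFactorial (L + 1) := by
    rcases a with _ | a <;> rcases b with _ | b <;> simp [eps]
  simp only [theta, Nat.succ_eq_add_one, h]

lemma theta_swap (L N K n k : ℕ) : theta L n k N K = -theta L N K n k := by
  simp [theta]

lemma basisBracket_eq_sum_range (c : R) (N K n k : ℕ) :
    basisBracket c (N, K) (n, k) = ∑ L ∈ Finset.range (K + k),
      Finsupp.single (N + n - (L + 1), K + k - (L + 1))
        ((K.choose (L + 1) * n.descFactorial (L + 1) -
          k.choose (L + 1) * N.descFactorial (L + 1) : R) * c ^ L) := by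
  have hshift := Finset.sum_Ico_add' (fun L => Finsupp.single (N + n - L, K + k - L)
    ((K.choose L * n.descFactorial L - k.choose L * N.descFactorial L : R) * c ^ (L - 1))) 0
    (K + k) 1
  simp only [Nat.add_sub_cancel] at hshift
  rw [Finset.range_eq_Ico, hshift, basisBracket]
  have hsub : Finset.Icc 1 (max (min K n) (min k N)) ⊆ Finset.Ico (0 + 1) (K + k + 1) := by
    intro L hL
    simp only [Finset.mem_Icc, Finset.mem_Ico] at hL ⊢
    omega
  rw [← Finset.sum_subset hsub]
  · refine Finset.sum_congr rfl fun L hL => ?_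
    rw [theta_of_pos (Finset.mem_Icc.1 hL).1]
    push_cast
    rfl
  · intro L hL hL'
    simp only [Finset.mem_Icc, Finset.mem_Ico] at hL hL'
    have h (a b : ℕ) (hab : min a b < L) : (a.choose L * b.descFactorial L : R) = 0 := by
      rcases min_lt_iff.1 hab with h | h
      · simp [Nat.choose_eq_zero_of_lt h]
      · simp [Nat.descFactorial_of_lt h]
    rw [h K n (by omega), h k N (by omega)]
    simp

lemma basisBracket_swap (c : R) (p q : ℕ × ℕ) : basisBracket c p q = -basisBracket c q p := by
  simp only [basisBracket, theta_swap _ p.1 p.2 q.1 q.2, add_comm q.1, add_comm q.2,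
    max_comm (min q.2 p.1), Int.cast_neg, neg_mul, Finsupp.single_neg, Finset.sum_neg_distrib,
    neg_neg]

lemma bracket_swap (c : R) (x y : (ℕ × ℕ) →₀ R) : bracket c x y = -bracket c y x := by
  induction x using Finsupp.induction_linear with
  | zero => simp
  | add u v hu hv => simp only [map_add, LinearMap.add_apply, hu, hv, neg_add]
  | single p r =>
    induction y using Finsupp.induction_linear with
    | zero => simp
    | add u v hu hv => simp only [map_add, LinearMap.add_apply, hu, hv, neg_add]
    | single q s =>
      rw [bracket_single, bracket_single, basisBracket_swap, smul_neg, mul_comm]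

lemma smul_bracket (c : R) (x y : (ℕ × ℕ) →₀ R) :
    c • bracket c x y = star c x y - star c y x := by
  let m : ((ℕ × ℕ) →₀ R) →ₗ[R] ((ℕ × ℕ) →₀ R) →ₗ[R] ((ℕ × ℕ) →₀ R) := star c
  suffices h : c • bracket c + m.flip = m from
    eq_sub_of_add_eq (LinearMap.congr_fun (LinearMap.congr_fun h x) y)
  ext1 ⟨N, K⟩
  ext1
  ext1 ⟨n, k⟩
  ext1
  simp only [LinearMap.comp_apply, Finsupp.lsingle_apply, LinearMap.smul_apply,
    LinearMap.add_apply, LinearMap.flip_apply, m]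
  rw [← eq_sub_iff_add_eq, bracket_single, star_single_single c (Nat.le_add_right K k),
    star_single_single c (Nat.le_add_left k K), Finset.sum_range_succ', Finset.sum_range_succ',
    basisBracket_eq_sum_range, mul_one, one_smul, Finset.smul_sum, add_comm n N, add_comm k K]
  simp only [Nat.choose_zero_right, Nat.descFactorial_zero, add_sub_add_right_eq_sub]
  rw [← Finset.sum_sub_distrib]
  refine Finset.sum_congr rfl fun L _ => ?_
  rw [Finsupp.smul_single, ← Finsupp.single_sub, smul_eq_mul]
  congr 1
  ring

lemma jacobi_of_isUnit {c : R} (hc : IsUnit c) (x y z : (ℕ × ℕ) →₀ R) :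
    bracket c (bracket c x y) z + bracket c (bracket c y z) x + bracket c (bracket c z x) y =
      0 := by
  have h (x y z : (ℕ × ℕ) →₀ R) : c • c • bracket c (bracket c x y) z =
      star c x (star c y z) - star c y (star c x z) -
        (star c z (star c x y) - star c z (star c y x)) := by
    rw [smul_bracket, smul_sub, ← LinearMap.smul_apply, ← LinearMap.map_smul (star c),
      ← LinearMap.map_smul (star c z), smul_bracket]
    simp only [map_sub, LinearMap.sub_apply, star_star, Module.End.mul_apply]
  rw [← hc.smul_eq_zero, ← hc.smul_eq_zero]
  simp only [smul_add, h]
  abel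

lemma basisBracket_zero (N K n k : ℕ) :
    basisBracket (0 : R) (N, K) (n, k) =
      Finsupp.single (N + n - 1, K + k - 1) (K * n - k * N : R) := by
  rw [basisBracket_eq_sum_range]
  rcases Nat.eq_zero_or_pos (K + k) with h | h
  · obtain ⟨rfl, rfl⟩ := Nat.add_eq_zero_iff.1 h
    simp
  · rw [Finset.sum_eq_single_of_mem 0 (Finset.mem_range.2 h)]
    · simp
    · intro L _ hL
      simp [hL]

lemma bracket_basisBracket_zero (N K n k p q : ℕ) (t : R) :
    bracket (0 : R) (basisBracket 0 (N, K) (n, k)) (Finsupp.single (p, q) t) =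
      Finsupp.single (N + n + p - 2, K + k + q - 2)
        (t * (K * n - k * N) * ((K + k - 1) * p - q * (N + n - 1)) : R) := by
  rw [basisBracket_zero, bracket_single, basisBracket_zero, Finsupp.smul_single, smul_eq_mul,
    mul_comm _ t]
  rcases Nat.eq_zero_or_pos (N + n) with h | h
  · obtain ⟨rfl, rfl⟩ := Nat.add_eq_zero_iff.1 h
    simp
  rcases Nat.eq_zero_or_pos (K + k) with h' | h'
  · obtain ⟨rfl, rfl⟩ := Nat.add_eq_zero_iff.1 h'
    simp
  rw [Nat.cast_sub h, Nat.cast_sub h']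
  push_cast
  congr 2 <;> omega

lemma jacobi_zero (x y z : (ℕ × ℕ) →₀ R) :
    bracket 0 (bracket 0 x y) z + bracket 0 (bracket 0 y z) x + bracket 0 (bracket 0 z x) y =
      0 := by
  induction x using Finsupp.induction_linear with
  | zero => simp
  | add u v hu hv =>
    simp only [map_add, LinearMap.add_apply]
    refine Eq.trans ?_ ((congrArg₂ (· + ·) hu hv).trans (add_zero 0))
    abel
  | single a r =>
    induction y using Finsupp.induction_linear with
    | zero => simp
    | add u v hu hv =>
      simp only [map_add, LinearMap.add_apply]
      refine Eq.trans ?_ ((congrArg₂ (· + ·) hu hv).trans (add_zero 0))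
      abel
    | single b s =>
      induction z using Finsupp.induction_linear with
      | zero => simp
      | add u v hu hv =>
        simp only [map_add, LinearMap.add_apply]
        refine Eq.trans ?_ ((congrArg₂ (· + ·) hu hv).trans (add_zero 0))
        abel
      | single d t =>
        obtain ⟨N, K⟩ := a
        obtain ⟨n, k⟩ := b
        obtain ⟨p, q⟩ := d
        simp only [map_smul, LinearMap.smul_apply, bracket_single,
          bracket_basisBracket_zero, Finsupp.smul_single, smul_eq_mul]
        rw [show n + p + N = N + n + p by ring, show k + q + K = K + k + q by ring,
          show p + N + n = N + n + p by ring, show q + K + k = K + k + q by ring,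
          ← Finsupp.single_add, ← Finsupp.single_add, Finsupp.single_eq_zero]
        ring

end RHPWN

/-- For every `c ∈ ℂ` and every commutative `ℂ`-algebra `A` of test functions, the structure
constants of the renormalized higher powers of white noise (Ivanov's renormalization
`δˡ = c^{l−1} δ`) define a Lie algebra structure on the free `A`-module with basis
`{B^n_k : (n,k) ∈ ℕ×ℕ}`: there is a `ℂ`-bilinear, antisymmetric bracket satisfying the
Jacobi identity with
`⁅g·B^N_K, f·B^n_k⁆ = Σ_{L=1}^{max(min(K,n),min(k,N))} θ_L(N,K;n,k) c^{L−1} (gf)·B^{N+n−L}_{K+k−L}`. -/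
theorem exists_RHPWN_Ivanov_lieAlgebra (c : ℂ) (A : Type) [CommRing A] [Algebra ℂ A] :
    ∃ bracket : ((ℕ × ℕ) →₀ A) →ₗ[ℂ] ((ℕ × ℕ) →₀ A) →ₗ[ℂ] ((ℕ × ℕ) →₀ A),
      (∀ x y, bracket x y = - bracket y x) ∧
      (∀ x y z,
        bracket (bracket x y) z + bracket (bracket y z) x + bracket (bracket z x) y = 0) ∧
      (∀ (f g : A) (N K n k : ℕ),
        bracket (Finsupp.single (N, K) g) (Finsupp.single (n, k) f) =
          ∑ L ∈ Finset.Icc 1 (max (min K n) (min k N)),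
            ((theta L N K n k : ℂ) * c ^ (L - 1)) •
              Finsupp.single (N + n - L, K + k - L) (g * f)) := by
  refine ⟨(RHPWN.bracket (algebraMap ℂ A c)).restrictScalars₁₂ ℂ ℂ,
    fun x y => RHPWN.bracket_swap _ x y, fun x y z => ?_, fun f g N K n k => ?_⟩
  · simp only [LinearMap.restrictScalars₁₂_apply_apply]
    rcases eq_or_ne c 0 with rfl | hc
    · rw [map_zero]
      exact RHPWN.jacobi_zero x y z
    · exact RHPWN.jacobi_of_isUnit (hc.isUnit.map (algebraMap ℂ A)) x y z
  · rw [LinearMap.restrictScalars₁₂_apply_apply, RHPWN.bracket_single, RHPWN.basisBracket,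
      Finset.smul_sum]
    refine Finset.sum_congr rfl fun L _ => ?_
    rw [Finsupp.smul_single, Finsupp.smul_single, smul_eq_mul, Algebra.smul_def, mul_comm (g * f)]
    simp
end

section
/- Let H be the 3-dimensional complex Heisenberg Lie algebra with basis {a⁻, a⁺, E} and brackets ⁅a⁻, a⁺⁆ = E, ⁅a⁻, E⁆ = ⁅a⁺, E⁆ = 0. Then: (1) every antisymmetric bilinear map φ : H × H → ℂ is a 2-cocycle on H; and (2) a 2-cocycle φ on H is a coboundary if and only if φ(E, a⁺) = 0 and φ(E, a⁻) = 0. In particular, H admits nontrivial central extensions: any antisymmetric bilinear φ with (φ(E, a⁺), φ(E, a⁻)) ≠ (0,0) defines a nontrivial one-dimensional central extension of H. -/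
/-- The annihilator `a⁻`, first basis vector of the 3-dimensional Heisenberg algebra. -/
noncomputable def heisAm : Fin 3 → ℂ := Pi.single 0 1

/-- The creator `a⁺`, second basis vector of the 3-dimensional Heisenberg algebra. -/
noncomputable def heisAp : Fin 3 → ℂ := Pi.single 1 1

/-- The central element `E`, third basis vector of the 3-dimensional Heisenberg algebra. -/
noncomputable def heisE : Fin 3 → ℂ := Pi.single 2 1

/-- An alternating bilinear map on `ℂ³` is determined by its values on pairs of basis vectors. -/
theorem heis_skew_apply {M : Type*} [AddCommGroup M] [Module ℂ M]
    (B : (Fin 3 → ℂ) →ₗ[ℂ] (Fin 3 → ℂ) →ₗ[ℂ] M)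
    (hB : ∀ x y, B x y = - B y x) (x y : Fin 3 → ℂ) :
    B x y = (x 0 * y 1 - x 1 * y 0) • B heisAm heisAp
      + (x 0 * y 2 - x 2 * y 0) • B heisAm heisE
      + (x 1 * y 2 - x 2 * y 1) • B heisAp heisE := by
  have : IsAddTorsionFree M := .of_isTorsionFree ℂ M
  have hself : ∀ v, B v v = 0 := fun v => self_eq_neg.mp (hB v v)
  have hbasis : ∀ v : Fin 3 → ℂ, v = v 0 • heisAm + v 1 • heisAp + v 2 • heisE := by
    intro v
    ext i
    fin_cases i <;> simp [heisAm, heisAp, heisE]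
  conv_lhs => rw [hbasis x, hbasis y]
  simp only [map_add, map_smul, LinearMap.add_apply, LinearMap.smul_apply, hself,
    hB heisAp heisAm, hB heisE heisAm, hB heisE heisAp]
  module

/-- Let `H = ℂ³` with the Heisenberg bracket (`⁅a⁻,a⁺⁆ = E`, `⁅a⁻,E⁆ = ⁅a⁺,E⁆ = 0`).
Then: (1) every antisymmetric bilinear map `φ : H × H → ℂ` is a 2-cocycle;
(2) a 2-cocycle `φ` is a coboundary iff `φ(E,a⁺) = 0` and `φ(E,a⁻) = 0`;
(3) any antisymmetric bilinear `φ` with `(φ(E,a⁺), φ(E,a⁻)) ≠ (0,0)` is not a coboundary,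
hence defines a nontrivial one-dimensional central extension of `H`. -/
theorem heisenberg_central_extensions
    (br : (Fin 3 → ℂ) →ₗ[ℂ] (Fin 3 → ℂ) →ₗ[ℂ] (Fin 3 → ℂ))
    (hskew : ∀ x y, br x y = - br y x)
    (h1 : br heisAm heisAp = heisE)
    (h2 : br heisAm heisE = 0)
    (h3 : br heisAp heisE = 0) :
    (∀ φ : (Fin 3 → ℂ) →ₗ[ℂ] (Fin 3 → ℂ) →ₗ[ℂ] ℂ,
      (∀ x y, φ x y = - φ y x) →
      (∀ x y z, φ (br x y) z + φ (br y z) x + φ (br z x) y = 0)) ∧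
    (∀ φ : (Fin 3 → ℂ) →ₗ[ℂ] (Fin 3 → ℂ) →ₗ[ℂ] ℂ,
      (∀ x y, φ x y = - φ y x) →
      (∀ x y z, φ (br x y) z + φ (br y z) x + φ (br z x) y = 0) →
      ((∃ f : (Fin 3 → ℂ) →ₗ[ℂ] ℂ, ∀ x y, φ x y = f (br x y)) ↔
        (φ heisE heisAp = 0 ∧ φ heisE heisAm = 0))) ∧
    (∀ φ : (Fin 3 → ℂ) →ₗ[ℂ] (Fin 3 → ℂ) →ₗ[ℂ] ℂ,
      (∀ x y, φ x y = - φ y x) →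
      (φ heisE heisAp, φ heisE heisAm) ≠ (0, 0) →
      ¬ ∃ f : (Fin 3 → ℂ) →ₗ[ℂ] ℂ, ∀ x y, φ x y = f (br x y)) := by
  have hbr : ∀ x y, br x y = (x 0 * y 1 - x 1 * y 0) • heisE := by
    intro x y
    rw [heis_skew_apply br hskew x y, h1, h2, h3]
    simp
  have hvanish : ∀ φ : (Fin 3 → ℂ) →ₗ[ℂ] (Fin 3 → ℂ) →ₗ[ℂ] ℂ,
      (∃ f : (Fin 3 → ℂ) →ₗ[ℂ] ℂ, ∀ x y, φ x y = f (br x y)) →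
      φ heisE heisAp = 0 ∧ φ heisE heisAm = 0 := by
    rintro φ ⟨f, hf⟩
    constructor
    · rw [hf, hskew, h3, neg_zero, map_zero]
    · rw [hf, hskew, h2, neg_zero, map_zero]
  refine ⟨fun φ hφ x y z => ?_, fun φ hφ _ => ⟨hvanish φ, ?_⟩, fun φ _ hne hf => ?_⟩
  · have hE : ∀ v, φ heisE v = -(v 0 * φ heisAm heisE + v 1 * φ heisAp heisE) := by
      intro v
      rw [heis_skew_apply φ hφ heisE v]
      simp [heisE]
      ring
    simp only [hbr, map_smul, LinearMap.smul_apply, smul_eq_mul, hE]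
    ring
  · rintro ⟨hp, hm⟩
    refine ⟨φ heisAm heisAp • LinearMap.proj 2, fun x y => ?_⟩
    rw [heis_skew_apply φ hφ x y, hφ heisAm heisE, hφ heisAp heisE, hp, hm, hbr]
    simp [heisE]
  · obtain ⟨hp, hm⟩ := hvanish φ hf
    exact hne (by rw [hp, hm])
end

section
/- Let L be the 4-dimensional complex oscillator Lie algebra with basis {a⁻, a⁺, Λ, E} and brackets ⁅a⁻, a⁺⁆ = E, ⁅Λ, a⁺⁆ = a⁺, ⁅Λ, a⁻⁆ = −a⁻, with E central (⁅E, x⁆ = 0 for all x). Then every 2-cocycle on L is a coboundary; that is, for every bilinear φ : L × L → ℂ with φ(x,y) = −φ(y,x) and φ(⁅x,y⁆,z) + φ(⁅y,z⁆,x) + φ(⁅z,x⁆,y) = 0 for all x, y, z, there exists a linear functional f : L → ℂ with φ(x,y) = f(⁅x,y⁆). Hence all central extensions of the oscillator algebra are trivial. -/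
/-- The annihilator `a⁻`, first basis vector of the 4-dimensional oscillator algebra. -/
noncomputable def oscAm : Fin 4 → ℂ := Pi.single 0 1

/-- The creator `a⁺`, second basis vector of the 4-dimensional oscillator algebra. -/
noncomputable def oscAp : Fin 4 → ℂ := Pi.single 1 1

/-- The number operator `Λ`, third basis vector of the 4-dimensional oscillator algebra. -/
noncomputable def oscLam : Fin 4 → ℂ := Pi.single 2 1

/-- The central element `E`, fourth basis vector of the 4-dimensional oscillator algebra. -/
noncomputable def oscE : Fin 4 → ℂ := Pi.single 3 1

/-- Let `L = ℂ⁴` with the oscillator-algebra bracket (`⁅a⁻,a⁺⁆ = E`, `⁅Λ,a⁺⁆ = a⁺`,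
`⁅Λ,a⁻⁆ = −a⁻`, `E` central). Then every 2-cocycle on `L` is a coboundary; hence all
one-dimensional central extensions of the oscillator algebra are trivial. -/
theorem oscillator_cocycle_is_coboundary
    (br : (Fin 4 → ℂ) →ₗ[ℂ] (Fin 4 → ℂ) →ₗ[ℂ] (Fin 4 → ℂ))
    (hskew : ∀ x y, br x y = - br y x)
    (h1 : br oscAm oscAp = oscE)
    (h2 : br oscLam oscAp = oscAp)
    (h3 : br oscLam oscAm = - oscAm)
    (h4 : ∀ x, br oscE x = 0)
    (φ : (Fin 4 → ℂ) →ₗ[ℂ] (Fin 4 → ℂ) →ₗ[ℂ] ℂ)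
    (hφskew : ∀ x y, φ x y = - φ y x)
    (hφcocycle : ∀ x y z, φ (br x y) z + φ (br y z) x + φ (br z x) y = 0) :
    ∃ f : (Fin 4 → ℂ) →ₗ[ℂ] ℂ, ∀ x y, φ x y = f (br x y) := by
  have br_self (x) : br x x = 0 := self_eq_neg.mp (hskew x x)
  have φ_self (x) : φ x x = 0 := self_eq_neg.mp (hφskew x x)
  have h4' (x) : br x oscE = 0 := by rw [hskew, h4, neg_zero]
  have h1' : br oscAp oscAm = - oscE := by rw [hskew, h1]
  have h2' : br oscAp oscLam = - oscAp := by rw [hskew, h2]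
  have h3' : br oscAm oscLam = oscAm := by rw [hskew, h3, neg_neg]
  have φ_E_Lam : φ oscE oscLam = 0 := by
    have h := hφcocycle oscAm oscAp oscLam
    rw [h1, h2', h3, hφskew (- oscAp)] at h
    simpa using h
  have φ_Am_E : φ oscAm oscE = 0 := by
    simpa [h3', h4, h4'] using hφcocycle oscAm oscLam oscE
  have φ_Ap_E : φ oscAp oscE = 0 := by
    simpa [h2, h4, h4'] using hφcocycle oscLam oscAp oscE
  let f : (Fin 4 → ℂ) →ₗ[ℂ] ℂ := (Pi.basisFun ℂ (Fin 4)).constr ℂ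
    ![- φ oscLam oscAm, φ oscLam oscAp, 0, φ oscAm oscAp]
  have f_Am : f oscAm = - φ oscLam oscAm := by
    simp [f, oscAm, Module.Basis.constr_apply_fintype, Fin.sum_univ_four]
  have f_Ap : f oscAp = φ oscLam oscAp := by
    simp [f, oscAp, Module.Basis.constr_apply_fintype, Fin.sum_univ_four]
  have f_E : f oscE = φ oscAm oscAp := by
    simp [f, oscE, Module.Basis.constr_apply_fintype, Fin.sum_univ_four]
  refine ⟨f, fun x y ↦ ?_⟩
  suffices h : φ = br.compr₂ f from LinearMap.congr_fun₂ h x y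
  have basis_eq : (Pi.basisFun ℂ (Fin 4) : Fin 4 → Fin 4 → ℂ) = ![oscAm, oscAp, oscLam, oscE] := by
    funext i
    fin_cases i <;> simp [oscAm, oscAp, oscLam, oscE]
  refine LinearMap.ext_basis (Pi.basisFun ℂ (Fin 4)) (Pi.basisFun ℂ (Fin 4)) fun i j ↦ ?_
  rw [basis_eq, LinearMap.compr₂_apply]
  fin_cases i <;> fin_cases j <;>
    simp [br_self, φ_self, h1, h1', h2, h2', h3, h3', h4, h4', f_Am, f_Ap, f_E, φ_E_Lam, φ_Am_E,
      φ_Ap_E, hφskew oscAp oscAm, hφskew oscAp oscLam, hφskew oscAm oscLam, hφskew oscLam oscE,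
      hφskew oscE oscAm, hφskew oscE oscAp]
end

section
/- Let L be the complex Lie algebra with basis {B^n_k : (n,k) ∈ ℕ×ℕ} and bracket determined by ⁅B^n_k, B^N_K⁆ = (kN − nK)·B^{n+N−1}_{k+K−1} (the right-hand side being 0 when kN − nK = 0). Then every 2-cocycle on L is a coboundary; that is, for every bilinear φ : L × L → ℂ with φ(x,y) = −φ(y,x) and φ(⁅x,y⁆,z) + φ(⁅y,z⁆,x) + φ(⁅z,x⁆,y) = 0 for all x, y, z, there exists a linear functional f : L → ℂ with φ(x,y) = f(⁅x,y⁆). Hence all central extensions of the RHPWN Lie algebra are trivial. -/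
/-- Let `L` be the complex Lie algebra with basis `{B^n_k : (n,k) ∈ ℕ×ℕ}` and bracket
determined by `⁅B^n_k, B^N_K⁆ = (kN − nK) B^{n+N−1}_{k+K−1}` (the RHPWN Lie algebra).
Then every 2-cocycle on `L` is a coboundary; hence all central extensions of the RHPWN
Lie algebra are trivial. -/
theorem RHPWN_cocycle_is_coboundary
    (br : ((ℕ × ℕ) →₀ ℂ) →ₗ[ℂ] ((ℕ × ℕ) →₀ ℂ) →ₗ[ℂ] ((ℕ × ℕ) →₀ ℂ))
    (hbr : ∀ n k N K : ℕ,
      br (Finsupp.single (n, k) 1) (Finsupp.single (N, K) 1) =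
        ((k * N - n * K : ℤ) : ℂ) • Finsupp.single (n + N - 1, k + K - 1) 1)
    (φ : ((ℕ × ℕ) →₀ ℂ) →ₗ[ℂ] ((ℕ × ℕ) →₀ ℂ) →ₗ[ℂ] ℂ)
    (hφskew : ∀ x y, φ x y = - φ y x)
    (hφcocycle : ∀ x y z, φ (br x y) z + φ (br y z) x + φ (br z x) y = 0) :
    ∃ f : ((ℕ × ℕ) →₀ ℂ) →ₗ[ℂ] ℂ, ∀ x y, φ x y = f (br x y) := by
  set a : ℕ → ℕ → ℕ → ℕ → ℂ := fun n k N K =>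
    φ (Finsupp.single (n, k) 1) (Finsupp.single (N, K) 1) with ha
  have skew (n k N K : ℕ) : a n k N K = - a N K n k := hφskew _ _
  -- The cocycle identity evaluated at `B^0_1` and two further generators.
  have coc (n k N K : ℕ) :
      (n : ℂ) * a (n - 1) k N K + ((k : ℂ) * N - n * K) * a (n + N - 1) (k + K - 1) 0 1
        - N * a (N - 1) K n k = 0 := by
    have h := hφcocycle (Finsupp.single (0, 1) 1) (Finsupp.single (n, k) 1)
      (Finsupp.single (N, K) 1)
    simp only [hbr, map_smul, LinearMap.smul_apply, smul_eq_mul] at h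
    simp only [Nat.zero_add, Nat.add_zero, Nat.add_sub_cancel, Nat.add_sub_cancel_left] at h
    push_cast at h
    simp only [ha]
    linear_combination h
  have pure_zero (K : ℕ) : a 0 1 0 K = 0 := by
    have h := coc 0 K 1 1
    have h2 := skew 0 K 0 1
    simp only [Nat.zero_add, Nat.add_sub_cancel, Nat.sub_self, Nat.cast_zero, Nat.cast_one,
      h2] at h
    have h3 : ((K : ℂ) + 1) * a 0 1 0 K = 0 := by linear_combination -h
    exact (mul_eq_zero.mp h3).resolve_left (Nat.cast_add_one_ne_zero K)
  set g : ℕ × ℕ → ℂ := fun q => a 0 1 (q.1 + 1) q.2 / ((q.1 : ℂ) + 1) with hg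
  have shift (M K : ℕ) : a 0 1 M K = M * g (M - 1, K) := by
    cases M with
    | zero => simp [pure_zero]
    | succ M =>
      have : (M : ℂ) + 1 ≠ 0 := Nat.cast_add_one_ne_zero M
      simp only [hg, Nat.add_sub_cancel]
      push_cast
      field_simp
  have key (N K k : ℕ) : ∀ n : ℕ,
      a n k N K = ((k : ℂ) * N - n * K) * g (n + N - 1, k + K - 1) := by
    induction N with
    | zero =>
      intro n
      have h := coc (n + 1) k 0 K
      have hn : (n : ℂ) + 1 ≠ 0 := Nat.cast_add_one_ne_zero n
      rw [skew _ _ 0 1, shift] at h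
      simp only [Nat.add_zero, Nat.add_sub_cancel] at h ⊢
      push_cast at h ⊢
      apply mul_left_cancel₀ hn
      linear_combination h
    | succ N ih =>
      intro n
      have h := coc (n + 1) k (N + 1) K
      have hn : (n : ℂ) + 1 ≠ 0 := Nat.cast_add_one_ne_zero n
      have h2 := ih (n + 1)
      rw [skew _ _ 0 1, shift, skew _ _ (n + 1) k] at h
      have e1 : n + 1 + (N + 1) - 1 = n + N + 1 := by omega
      have e2 : n + 1 + N - 1 = n + N := by omega
      have e3 : n + (N + 1) - 1 = n + N := by omega
      simp only [e1, e2, e3, Nat.add_sub_cancel] at h h2 ⊢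
      rw [h2] at h
      push_cast at h ⊢
      apply mul_left_cancel₀ hn
      linear_combination h
  refine ⟨Finsupp.linearCombination ℂ g, fun x y => ?_⟩
  suffices h : φ = br.compr₂ (Finsupp.linearCombination ℂ g) by
    rw [h, LinearMap.compr₂_apply]
  ext ⟨n, k⟩ ⟨N, K⟩
  have h := key N K k n
  simp only [LinearMap.coe_comp, Function.comp_apply, Finsupp.lsingle_apply,
    LinearMap.compr₂_apply, hbr, map_smul, Finsupp.linearCombination_single,
    smul_eq_mul, one_mul]
  push_cast
  exact h
end
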